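/- Assume f_1 ≥ f_2 ≥ … ≥ f_n ≥ 0 and b_1 ≥ b_2 ≥ … ≥ b_m. Then the northwest-corner (greedy) solution x^g belongs to 𝒳, and cost_f(x^g) ≤ ∑_{i=1}^{n} (f_i − f_{i+1}) · π(a_1 + … + a_i) + ∑_{i=2}^{n} f_i. -/

import Mathlib

open Finset

/-- Sum of the first `t` entries of a vector indexed by `Fin k`. -/
def partialSum {k : ℕ} (c : Fin k → ℤ) (t : ℕ) : ℤ :=
  ∑ i : Fin k, if (i : ℕ) < t then c i else 0

/-- `π(t)`: the smallest `j` such that the first `j` sinks have total demand at least `t`. -/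
noncomputable def piFn {m : ℕ} (b : Fin m → ℤ) (t : ℝ) : ℕ :=
  sInf {k : ℕ | t ≤ (partialSum b k : ℝ)}

/-- Extension of the cost vector with `f_{n+1} = 0`. -/
noncomputable def fext {n : ℕ} (f : Fin n → ℝ) (k : ℕ) : ℝ :=
  if h : k < n then f ⟨k, h⟩ else 0

/-- PFCT-S cost of a solution `x`: `∑_{(i,j) : x_{ij} > 0} f_i`. -/
noncomputable def costF {n m : ℕ} (f : Fin n → ℝ) (x : Fin n → Fin m → ℝ) : ℝ :=
  ∑ i : Fin n, ∑ j : Fin m, if 0 < x i j then f i else 0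

/-- The northwest-corner (greedy) solution
`x^g_{ij} = max(0, min(A_i, B_j) − max(A_{i−1}, B_{j−1}))`. -/
def greedy {n m : ℕ} (a : Fin n → ℤ) (b : Fin m → ℤ) : Fin n → Fin m → ℝ :=
  fun i j =>
    max 0 (min ((partialSum a ((i : ℕ) + 1) : ℤ) : ℝ) ((partialSum b ((j : ℕ) + 1) : ℤ) : ℝ)
      - max ((partialSum a (i : ℕ) : ℤ) : ℝ) ((partialSum b (j : ℕ) : ℤ) : ℝ))

lemma partialSum_zero {k : ℕ} (c : Fin k → ℤ) : partialSum c 0 = 0 := by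
  simp [partialSum]

lemma partialSum_of_le {k t : ℕ} (c : Fin k → ℤ) (h : k ≤ t) : partialSum c t = ∑ i, c i :=
  Finset.sum_congr rfl fun i _ => if_pos (i.isLt.trans_le h)

lemma partialSum_succ {k : ℕ} (c : Fin k → ℤ) (i : Fin k) :
    partialSum c (i + 1) = partialSum c i + c i := by
  have h : c i = ∑ j : Fin k, if j = i then c j else 0 := by simp
  rw [partialSum, partialSum, h, ← Finset.sum_add_distrib]
  refine Finset.sum_congr rfl fun j _ => ?_
  by_cases hji : j = i
  · subst hji
    simp
  · have : (j : ℕ) ≠ i := fun h => hji (Fin.ext h)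
    have : (j : ℕ) < i + 1 ↔ (j : ℕ) < i := by omega
    simp [hji, this]

lemma partialSum_mono {k : ℕ} {c : Fin k → ℤ} (hc : ∀ i, 0 < c i) : Monotone (partialSum c) := by
  intro s t hst
  refine Finset.sum_le_sum fun i _ => ?_
  have := hc i
  split_ifs <;> omega

lemma greedy_comm {n m : ℕ} (a : Fin n → ℤ) (b : Fin m → ℤ) (i : Fin n) (j : Fin m) :
    greedy a b i j = greedy b a j i := by
  rw [greedy, greedy, min_comm, max_comm (partialSum a i : ℝ)]

/-- The overlap of two intervals, as an increment of the clamp onto the first one. -/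
lemma overlap_eq_clamp_sub {p q u v : ℝ} (hpq : p ≤ q) (huv : u ≤ v) :
    max 0 (min q v - max p u) = max p (min q v) - max p (min q u) := by
  grind

lemma sum_greedy_row {n m : ℕ} {a : Fin n → ℤ} {b : Fin m → ℤ} (ha : ∀ i, 0 < a i)
    (hb : ∀ j, 0 < b j) (hab : ∑ i, a i = ∑ j, b j) (i : Fin n) :
    ∑ j, greedy a b i j = (a i : ℝ) := by
  have hA : partialSum a i ≤ partialSum a (i + 1) := partialSum_mono ha (Nat.le_succ _)
  have hA0 : 0 ≤ partialSum a i := by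
    rw [← partialSum_zero a]; exact partialSum_mono ha (Nat.zero_le _)
  have hAm : partialSum a (i + 1) ≤ partialSum b m := by
    rw [partialSum_of_le b le_rfl, ← hab, ← partialSum_of_le a le_rfl]
    exact partialSum_mono ha i.isLt
  have hsucc : (partialSum a (i + 1) : ℝ) = partialSum a i + a i := by
    exact_mod_cast partialSum_succ a i
  set c : ℕ → ℝ := fun k => max (partialSum a i : ℝ) (min (partialSum a (i + 1)) (partialSum b k))
  have hterm (j : Fin m) : greedy a b i j = c (j + 1) - c j :=
    overlap_eq_clamp_sub (by exact_mod_cast hA)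
      (by exact_mod_cast partialSum_mono hb (Nat.le_succ _))
  have h0 : c 0 = partialSum a i := by
    refine max_eq_left ((min_le_right _ _).trans ?_)
    rw [partialSum_zero]
    exact_mod_cast hA0
  have hm : c m = partialSum a (i + 1) := by
    have : ((partialSum a (i + 1) : ℤ) : ℝ) ≤ partialSum b m := by exact_mod_cast hAm
    simp only [c]
    rw [min_eq_left this]
    exact max_eq_right (by exact_mod_cast hA)
  simp only [hterm]
  rw [Fin.sum_univ_eq_sum_range (fun k => c (k + 1) - c k), Finset.sum_range_sub, h0, hm, hsucc]
  ring

lemma piFn_le {m : ℕ} {b : Fin m → ℤ} {t : ℝ} {k : ℕ} (h : t ≤ partialSum b k) :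
    piFn b t ≤ k :=
  Nat.sInf_le h

lemma le_partialSum_piFn {m : ℕ} {b : Fin m → ℤ} {t : ℝ} (h : t ≤ partialSum b m) :
    t ≤ partialSum b (piFn b t) :=
  Nat.sInf_mem (s := {k : ℕ | t ≤ (partialSum b k : ℝ)}) ⟨m, h⟩

lemma card_greedy_row_pos_le {n m : ℕ} {a : Fin n → ℤ} {b : Fin m → ℤ} (ha : ∀ i, 0 < a i)
    (hb : ∀ j, 0 < b j) (hab : ∑ i, a i = ∑ j, b j) (i : Fin n) :
    #{j | 0 < greedy a b i j} + piFn b (partialSum a i)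
      ≤ piFn b (partialSum a (i + 1)) + if (i : ℕ) = 0 then 0 else 1 := by
  have hA : ((partialSum a i : ℤ) : ℝ) ≤ partialSum a (i + 1) := by
    exact_mod_cast partialSum_mono ha (Nat.le_succ _)
  have hAm : ((partialSum a (i + 1) : ℤ) : ℝ) ≤ partialSum b m := by
    rw [partialSum_of_le b le_rfl, ← hab, ← partialSum_of_le a le_rfl]
    exact_mod_cast partialSum_mono ha i.isLt
  have hq := le_partialSum_piFn hAm
  have hmono : piFn b (partialSum a i) ≤ piFn b (partialSum a (i + 1)) := piFn_le (hA.trans hq)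
  have hcard : #{j | 0 < greedy a b i j} ≤
      #(Finset.Ico (piFn b (partialSum a i) - 1) (piFn b (partialSum a (i + 1)))) := by
    refine Finset.card_le_card_of_injOn (fun j : Fin m => (j : ℕ)) (fun j hj => ?_)
      Fin.val_injective.injOn
    have hj : 0 < greedy a b i j := by simpa using hj
    rw [greedy, lt_max_iff, or_iff_right (lt_irrefl _), sub_pos, lt_min_iff, max_lt_iff,
      max_lt_iff] at hj
    obtain ⟨⟨-, hlt⟩, hlt', -⟩ := hj
    have h1 : piFn b (partialSum a i) ≤ j + 1 := piFn_le hlt'.le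
    have h2 : (j : ℕ) < piFn b (partialSum a (i + 1)) := by
      by_contra! h
      have : ((partialSum b (piFn b (partialSum a (i + 1))) : ℤ) : ℝ) ≤ partialSum b j := by
        exact_mod_cast partialSum_mono hb h
      linarith
    simp only [Finset.coe_Ico, Set.mem_Ico]
    omega
  rw [Nat.card_Ico] at hcard
  split_ifs with h0
  · have : piFn b (partialSum a i) = 0 := by
      refine Nat.le_zero.mp (piFn_le ?_)
      rw [h0, partialSum_zero, partialSum_zero]
    omega
  · omega

lemma sum_range_mul_sub_by_parts (F q : ℕ → ℝ) (n : ℕ) :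
    ∑ i ∈ range n, F i * (q (i + 1) - q i)
      = ∑ i ∈ range n, (F i - F (i + 1)) * q (i + 1) + F n * q n - F 0 * q 0 := by
  induction n with
  | zero => simp
  | succ n ih => rw [sum_range_succ, sum_range_succ, ih]; ring

/-- the greedy (northwest-corner) solution is feasible and its PFCT-S cost is
at most `∑_{i=1}^{n} (f_i − f_{i+1}) π(a_1+…+a_i) + ∑_{i=2}^{n} f_i`. -/
theorem stmt_2
    (n m : ℕ) (hn : 0 < n) (hm : 0 < m)
    (a : Fin n → ℤ) (ha : ∀ i, 0 < a i)
    (b : Fin m → ℤ) (hb : ∀ j, 0 < b j)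
    (hab : ∑ i, a i = ∑ j, b j)
    (f : Fin n → ℝ) (hf0 : ∀ i, 0 ≤ f i)
    (hfmono : ∀ i i' : Fin n, i ≤ i' → f i' ≤ f i)
    (hbmono : ∀ j j' : Fin m, j ≤ j' → b j' ≤ b j) :
    ((∀ i j, 0 ≤ greedy a b i j) ∧ (∀ i, ∑ j, greedy a b i j = (a i : ℝ)) ∧
      (∀ j, ∑ i, greedy a b i j = (b j : ℝ))) ∧
    costF f (greedy a b) ≤
      (∑ i ∈ Finset.range n,
        (fext f i - fext f (i + 1)) * (piFn b ((partialSum a (i + 1) : ℤ) : ℝ) : ℝ))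
      + ∑ i ∈ Finset.Ico 1 n, fext f i := by
  refine ⟨⟨fun i j => le_max_left _ _, sum_greedy_row ha hb hab, fun j => ?_⟩, ?_⟩
  · simp only [greedy_comm a b]
    exact sum_greedy_row hb ha hab.symm j
  set q : ℕ → ℝ := fun k => (piFn b ((partialSum a k : ℤ) : ℝ) : ℝ) with hq
  have hrow (i : Fin n) : (∑ j : Fin m, if 0 < greedy a b i j then f i else 0) ≤
      fext f i * (q (i + 1) - q i) + if (i : ℕ) = 0 then 0 else fext f i := by
    have hfi : fext f i = f i := dif_pos i.isLt
    have hc : (#{j | 0 < greedy a b i j} : ℝ) + q i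
        ≤ q (i + 1) + if (i : ℕ) = 0 then 0 else 1 := by
      simp only [hq]
      exact_mod_cast card_greedy_row_pos_le ha hb hab i
    rw [← Finset.sum_filter, Finset.sum_const, nsmul_eq_mul, hfi]
    have := mul_le_mul_of_nonneg_left hc (hf0 i)
    split_ifs at this ⊢ <;> linarith
  have hFn : fext f n = 0 := dif_neg (lt_irrefl n)
  have hq0 : q 0 = 0 := by
    have : piFn b ((partialSum a 0 : ℤ) : ℝ) = 0 :=
      Nat.le_zero.mp (piFn_le (by rw [partialSum_zero, partialSum_zero]))
    simp [hq, this]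
  have htail : (∑ i ∈ range n, if i = 0 then 0 else fext f i) = ∑ i ∈ Ico 1 n, fext f i := by
    rw [Finset.range_eq_Ico, Finset.sum_eq_sum_Ico_succ_bot hn, if_pos rfl, zero_add]
    exact Finset.sum_congr rfl fun i hi => if_neg (by have := (mem_Ico.mp hi).1; omega)
  refine (Finset.sum_le_sum fun i _ => hrow i).trans_eq ?_
  rw [Fin.sum_univ_eq_sum_range
      (fun k => fext f k * (q (k + 1) - q k) + if k = 0 then 0 else fext f k),
    Finset.sum_add_distrib, htail, sum_range_mul_sub_by_parts, hFn, hq0]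
  ring
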